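/- Let D be a deformation space with associated family A_min, let G₀ ∉ A_min be a maximal elliptic subgroup with peripheral structure M₀, let T be a tree in the reduced deformation space D_r, and let v be the unique vertex of T with stabilizer G₀. Then: (1) if an edge e is adjacent to v, there exists m ∈ M₀ such that G_e is contained in a group belonging to m; (2) for every m ∈ M₀ there exists an edge e adjacent to v such that G_e belongs to m; (3) the image of v in the quotient graph Γ = T/G has valence at least |M₀|, and in particular M₀ is finite; (4) there exists T' ∈ D_r such that the valence of the image of v equals |M₀|. -/

import Mathlib

set_option autoImplicit false
set_option maxHeartbeats 1000000
open scoped Classical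

universe u

section Trees

variable (G : Type u) [Group G]

/-- A (minimal, simplicial) `G`-tree: a simplicial tree together with an action of `G` by
simplicial automorphisms, without inversions, admitting no proper invariant subtree. -/
structure GTree : Type (u + 1) where
  V : Type u
  nonempty : Nonempty V
  graph : SimpleGraph V
  isTree : graph.IsTree
  act : G →* Equiv.Perm V
  adj_act : ∀ (g : G) (u v : V), graph.Adj u v → graph.Adj (act g u) (act g v)
  noInversion : ∀ (g : G) (u v : V), graph.Adj u v → ¬(act g u = v ∧ act g v = u)
  minimal : ∀ S : Set V, S.Nonempty → (∀ (g : G), ∀ v ∈ S, act g v ∈ S) →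
      (∀ u ∈ S, ∀ v ∈ S, ∀ p : graph.Walk u v, p.IsPath → ∀ w ∈ p.support, w ∈ S) →
      S = Set.univ

variable {G}

namespace GTree

variable (T : GTree G)

/-- The stabilizer of a vertex. -/
def stab (v : T.V) : Subgroup G where
  carrier := {g : G | T.act g v = v}
  one_mem' := by simp
  mul_mem' := by
    intro a b ha hb
    simp only [Set.mem_setOf_eq, map_mul, Equiv.Perm.mul_apply] at *
    rw [hb, ha]
  inv_mem' := by
    intro a ha
    simp only [Set.mem_setOf_eq] at *
    have h : T.act a⁻¹ (T.act a v) = v := by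
      rw [← Equiv.Perm.mul_apply, ← map_mul, inv_mul_cancel, map_one, Equiv.Perm.one_apply]
    rwa [ha] at h

/-- The (pointwise) stabilizer of an edge `uv`; since the action has no inversions this is
the full stabilizer of the edge. -/
def edgeStab (u v : T.V) : Subgroup G := T.stab u ⊓ T.stab v

/-- A subgroup of `G` is elliptic if it fixes a vertex. -/
def Elliptic (H : Subgroup G) : Prop := ∃ v : T.V, ∀ h ∈ H, T.act h v = v

/-- An element of `G` is elliptic if it fixes a vertex. -/
def EllipticElt (g : G) : Prop := ∃ v : T.V, T.act g v = v

/-- An element of `G` is hyperbolic if it fixes no vertex. -/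
def Hyperbolic (g : G) : Prop := ∀ v : T.V, T.act g v ≠ v

/-- A `G`-tree is reduced if whenever the stabilizer of an edge `uv` equals the stabilizer
of `u` (i.e. `G_u ≤ G_v`), the two endpoints are in the same orbit. -/
def Reduced : Prop :=
  ∀ u v : T.V, T.graph.Adj u v → T.stab u ≤ T.stab v → ∃ g : G, T.act g u = v

/-- `T` is a single point. -/
protected def Trivial : Prop := ∀ u v : T.V, u = v

/-- `T` is a (simplicial) line. -/
def IsLine : Prop := ∀ v : T.V, ∃ a b : T.V, a ≠ b ∧ {w : T.V | T.graph.Adj v w} = {a, b}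

/-- `G` fixes an end of `T`: there is an equivariant choice, for each vertex, of the next
vertex in the direction of the fixed end. -/
def FixesEnd : Prop :=
  ∃ next : T.V → T.V, (∀ v, T.graph.Adj v (next v)) ∧
    (∀ (g : G) (v : T.V), next (T.act g v) = T.act g (next v)) ∧
    (∀ v, next (next v) ≠ v)

/-- Linear abelian type: `T` is a line on which `G` acts by translations (every element acts
either trivially or freely). -/
def LinearAbelian : Prop :=
  T.IsLine ∧ ∀ g : G, (∀ v : T.V, T.act g v = v) ∨ (∀ v : T.V, T.act g v ≠ v)

/-- Dihedral type: `T` is a line and some element acts as a reflection. -/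
def Dihedral : Prop :=
  T.IsLine ∧ ∃ g : G, (∃ v : T.V, T.act g v = v) ∧ (∃ w : T.V, T.act g w ≠ w)

/-- Genuine abelian type: `G` fixes an end and `T` is not a line. -/
def GenuineAbelian : Prop := T.FixesEnd ∧ ¬T.IsLine

/-- Irreducibility, via the characterization by hyperbolicity of a commutator. -/
def Irred : Prop :=
  ∃ g h : G, T.Hyperbolic g ∧ T.Hyperbolic h ∧ T.Hyperbolic (g * h * g⁻¹ * h⁻¹)

/-- The image of a dart (oriented edge) under the action of `g`. -/
def dartAct (g : G) (d : T.graph.Dart) : T.graph.Dart :=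
  ⟨(T.act g d.toProd.1, T.act g d.toProd.2), T.adj_act g d.toProd.1 d.toProd.2 d.adj⟩

/-- Three oriented edges are aligned (in this order) if some geodesic crosses them
successively, with the correct orientations. -/
def Aligned (d₁ d₂ d₃ : T.graph.Dart) : Prop :=
  ∃ (u v : T.V) (p : T.graph.Walk u v), p.IsPath ∧ [d₁, d₂, d₃].Sublist p.darts

end GTree

/-- Two `G`-trees lie in the same deformation space iff they have the same elliptic
subgroups. -/
def SameDef (T T' : GTree G) : Prop := ∀ H : Subgroup G, T.Elliptic H ↔ T'.Elliptic H

/-- An equivariant isomorphism of simplicial `G`-trees. -/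
def SimpIso (T T' : GTree G) : Prop :=
  ∃ e : T.V ≃ T'.V, (∀ (g : G) (v : T.V), e (T.act g v) = T'.act g (e v)) ∧
    ∀ u v : T.V, T.graph.Adj u v ↔ T'.graph.Adj (e u) (e v)

end Trees
section Collapses

variable {G : Type u} [Group G]

/-- Two ordered pairs of adjacent vertices span edges in the same `G`-orbit
(as non-oriented edges). -/
def InEdgeOrbit (T : GTree G) (a b c d : T.V) : Prop :=
  ∃ g : G, (T.act g a = c ∧ T.act g b = d) ∨ (T.act g a = d ∧ T.act g b = c)

/-- `c` exhibits `T'` as a (possibly non-elementary) collapse of `T`: it is equivariant,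
surjective, sends non-collapsed edges to edges, is onto the edges of `T'`, and its point
preimages are subtrees. -/
def IsCollapseMap (T T' : GTree G) (c : T.V → T'.V) : Prop :=
  (∀ (g : G) (v : T.V), c (T.act g v) = T'.act g (c v)) ∧
  Function.Surjective c ∧
  (∀ u v : T.V, T.graph.Adj u v → c u ≠ c v → T'.graph.Adj (c u) (c v)) ∧
  (∀ u' v' : T'.V, T'.graph.Adj u' v' → ∃ u v : T.V, T.graph.Adj u v ∧ c u = u' ∧ c v = v') ∧
  (∀ u v : T.V, c u = c v → ∀ p : T.graph.Walk u v, p.IsPath → ∀ w ∈ p.support, c w = c u)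

/-- `T'` is obtained from `T` by a (possibly non-elementary) collapse. -/
def CollapseOf (T' T : GTree G) : Prop := ∃ c : T.V → T'.V, IsCollapseMap T T' c

/-- `T'` is obtained from `T` by collapsing (exactly) all the edges in the orbit of a
single edge. -/
def IsOrbitCollapse (T' T : GTree G) : Prop :=
  ∃ (c : T.V → T'.V) (u₀ v₀ : T.V), T.graph.Adj u₀ v₀ ∧ IsCollapseMap T T' c ∧
    ∀ u v : T.V, T.graph.Adj u v → (c u = c v ↔ InEdgeOrbit T u v u₀ v₀)

/-- An elementary collapse: collapsing the orbit of a collapsible edge, i.e. an orbit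
collapse staying in the same deformation space. -/
def ElemCollapse (T T' : GTree G) : Prop := IsOrbitCollapse T' T ∧ SameDef T T'

/-- An elementary move: an elementary collapse or an elementary expansion. -/
def ElemMove (T T' : GTree G) : Prop := ElemCollapse T T' ∨ ElemCollapse T' T

/-- An elementary deformation: a finite sequence of elementary collapses and expansions. -/
def ElemDeformation (T T' : GTree G) : Prop := Relation.ReflTransGen ElemMove T T'

/-- A slide move: an edge `f = vx` with `G_f ≤ G_e` slides across `e = vw` (and
equivariantly so does its orbit), becoming an edge `f' = wx`. -/
def SlideMove (T T' : GTree G) : Prop :=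
  ∃ (e : T.V ≃ T'.V) (v w x : T.V),
    T.graph.Adj v w ∧ T.graph.Adj v x ∧ w ≠ x ∧
    T.edgeStab v x ≤ T.edgeStab v w ∧
    ¬InEdgeOrbit T v w v x ∧
    (∀ (g : G) (u : T.V), e (T.act g u) = T'.act g (e u)) ∧
    (∀ a b : T.V, T'.graph.Adj (e a) (e b) ↔
      ((T.graph.Adj a b ∧ ¬InEdgeOrbit T a b v x) ∨ InEdgeOrbit T a b w x))

end Collapses

section MetricTrees

variable (G : Type u) [Group G]

/-- A metric `G`-tree: a simplicial `G`-tree together with an equivariant assignment of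
positive lengths to the edges. -/
structure MGTree extends GTree G : Type (u + 1) where
  len : V → V → ℝ
  len_symm : ∀ u v : V, len u v = len v u
  len_pos : ∀ u v : V, graph.Adj u v → 0 < len u v
  len_equivariant : ∀ (g : G) (u v : V), len (act g u) (act g v) = len u v

variable {G}

namespace MGTree

variable (T : MGTree G)

/-- The length of a walk. -/
noncomputable def walkLen {u v : T.V} (p : T.graph.Walk u v) : ℝ :=
  (p.darts.map fun d => T.len d.toProd.1 d.toProd.2).sum

/-- The distance between two vertices: the length of the unique reduced path joining them. -/
noncomputable def dist (u v : T.V) : ℝ :=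
  sInf {x : ℝ | ∃ p : T.graph.Walk u v, p.IsPath ∧ x = T.walkLen p}

/-- The translation length of `g`. -/
noncomputable def ell (g : G) : ℝ :=
  sInf {x : ℝ | ∃ v : T.V, x = T.dist v (T.act g v)}

/-- The axis (or characteristic set) of `g`: the set of points moved exactly `ℓ(g)`. -/
def Axis (g : G) : Set T.V := {v : T.V | T.dist v (T.act g v) = T.ell g}

/-- `T` is abelian: its length function is the absolute value of a homomorphism to `ℝ`
with cyclic image. -/
def IsAbelian : Prop :=
  ∃ φ : G → ℝ, (∀ g h : G, φ (g * h) = φ g + φ h) ∧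
    (∃ a : ℝ, ∀ g : G, ∃ n : ℤ, φ g = (n : ℝ) * a) ∧
    ∀ g : G, T.ell g = |φ g|

/-- Irreducibility for metric trees: two hyperbolic elements with disjoint axes. -/
def Irr : Prop :=
  ∃ g h : G, T.toGTree.Hyperbolic g ∧ T.toGTree.Hyperbolic h ∧ T.Axis g ∩ T.Axis h = ∅

end MGTree

/-- An equivariant simplicial isomorphism multiplying all edge lengths by `c`. -/
def EquivHomothety (c : ℝ) (T T' : MGTree G) : Prop :=
  ∃ e : T.V ≃ T'.V, (∀ (g : G) (v : T.V), e (T.act g v) = T'.act g (e v)) ∧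
    (∀ u v : T.V, T.graph.Adj u v ↔ T'.graph.Adj (e u) (e v)) ∧
    ∀ u v : T.V, T.graph.Adj u v → T'.len (e u) (e v) = c * T.len u v

/-- An equivariant isometry of metric `G`-trees. -/
def EquivIsometric (T T' : MGTree G) : Prop := EquivHomothety 1 T T'

/-- The action of an automorphism of `G` on metric `G`-trees, by precomposition. -/
def MGTree.precomp (φ : MulAut G) (T : MGTree G) : MGTree G where
  V := T.V
  nonempty := T.nonempty
  graph := T.graph
  isTree := T.isTree
  act := T.act.comp φ.toMonoidHom
  adj_act := fun g u v h => T.adj_act (φ g) u v h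
  noInversion := fun g u v h => T.noInversion (φ g) u v h
  minimal := fun S h1 h2 h3 => T.minimal S h1
    (fun g v hv => by simpa using h2 (φ.symm g) v hv) h3
  len := T.len
  len_symm := T.len_symm
  len_pos := T.len_pos
  len_equivariant := fun g u v => T.len_equivariant (φ g) u v

end MetricTrees
section Topologies

variable (G : Type u) [Group G]

/-- Basic Gromov–Hausdorff neighbourhood of the metric `G`-tree `T` determined by finite
sets `X ⊆ T`, `A ⊆ G` and `ε > 0`: the trees admitting an `ε`-approximate equivariant
lift of `X`. -/
def gromovBasic (T : MGTree G) (X : Finset T.V) (A : Finset G) (ε : ℝ) : Set (MGTree G) :=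
  {T' : MGTree G | ∃ f : T.V → T'.V, ∀ x ∈ X, ∀ y ∈ X, ∀ g ∈ A,
    |T.dist x (T.act g y) - T'.dist (f x) (T'.act g (f y))| < ε}

/-- The equivariant Gromov–Hausdorff topology on the space of metric `G`-trees. -/
noncomputable def gromovTop : TopologicalSpace (MGTree G) where
  IsOpen U := ∀ T ∈ U, ∃ (X : Finset T.V) (A : Finset G) (ε : ℝ), 0 < ε ∧
    gromovBasic G T X A ε ⊆ U
  isOpen_univ := fun T _ => ⟨∅, ∅, 1, one_pos, Set.subset_univ _⟩
  isOpen_inter := by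
    intro U V hU hV T hT
    obtain ⟨X₁, A₁, ε₁, hε₁, h₁⟩ := hU T hT.1
    obtain ⟨X₂, A₂, ε₂, hε₂, h₂⟩ := hV T hT.2
    refine ⟨X₁ ∪ X₂, A₁ ∪ A₂, min ε₁ ε₂, lt_min hε₁ hε₂, ?_⟩
    intro T' hT'
    obtain ⟨f, hf⟩ := hT'
    constructor
    · exact h₁ ⟨f, fun x hx y hy g hg =>
        lt_of_lt_of_le (hf x (Finset.mem_union_left _ hx) y (Finset.mem_union_left _ hy) g
          (Finset.mem_union_left _ hg)) (min_le_left _ _)⟩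
    · exact h₂ ⟨f, fun x hx y hy g hg =>
        lt_of_lt_of_le (hf x (Finset.mem_union_right _ hx) y (Finset.mem_union_right _ hy) g
          (Finset.mem_union_right _ hg)) (min_le_right _ _)⟩
  isOpen_sUnion := by
    intro s hs T hT
    obtain ⟨U, hUs, hTU⟩ := hT
    obtain ⟨X, A, ε, hε, h⟩ := hs U hUs T hTU
    exact ⟨X, A, ε, hε, h.trans (Set.subset_sUnion_of_mem hUs)⟩

variable {G}

/-- The closed cone of the (restricted) deformation space `D` spanned by `T`: the trees
of `D` obtained from trees having the same underlying simplicial tree as `T` by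
(elementary) collapses. -/
def closedCone (D : Set (MGTree G)) (T : MGTree G) : Set (MGTree G) :=
  {T' : MGTree G | T' ∈ D ∧ CollapseOf T'.toGTree T.toGTree}

/-- The open cone containing `T`: the trees with the same underlying simplicial tree. -/
def openCone (D : Set (MGTree G)) (T : MGTree G) : Set (MGTree G) :=
  {T' : MGTree G | T' ∈ D ∧ SimpIso T'.toGTree T.toGTree}

variable (G)

/-- The weak topology on a deformation space `D`: a set is closed if and only if its
intersection with every closed cone of `D` is closed (each closed cone carrying the
Gromov topology). -/
noncomputable def weakTop (D : Set (MGTree G)) : TopologicalSpace ↥D :=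
  ⨆ (T : MGTree G) (_ : T ∈ D), TopologicalSpace.coinduced
    (fun x : {S : MGTree G // S ∈ closedCone D T} => (⟨x.1, x.2.1⟩ : ↥D))
    (TopologicalSpace.induced (fun x : {S : MGTree G // S ∈ closedCone D T} => x.1)
      (gromovTop G))

variable {G}

/-- The projectivizing relation on a deformation space: agreement up to rescaling, i.e.
equivariant homothety. -/
def projRel (D : Set (MGTree G)) (a b : ↥D) : Prop :=
  ∃ c : ℝ, 0 < c ∧ EquivHomothety c a.1 b.1

/-- The relation of equivariant isometry on a deformation space. -/
def isomRel (D : Set (MGTree G)) (a b : ↥D) : Prop := EquivIsometric a.1 b.1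

end Topologies

section Morphisms

variable {G : Type u} [Group G]

/-- A morphism of simplicial `G`-trees: an equivariant map sending each edge onto a
non-degenerate edge path (obtained by subdividing the edge into finitely many subsegments,
each mapped bijectively onto an edge). -/
structure GMorphism (T T' : GTree G) where
  f : T.V → T'.V
  equivariant : ∀ (g : G) (v : T.V), f (T.act g v) = T'.act g (f v)
  edgeWalk : ∀ u v : T.V, T.graph.Adj u v → T'.graph.Walk (f u) (f v)
  edgeWalk_ne_nil : ∀ (u v : T.V) (h : T.graph.Adj u v), ¬(edgeWalk u v h).Nil
  edgeWalk_symm : ∀ (u v : T.V) (h : T.graph.Adj u v),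
    (edgeWalk v u h.symm).support = (edgeWalk u v h).support.reverse
  edgeWalk_equivariant : ∀ (g : G) (u v : T.V) (h : T.graph.Adj u v),
    (edgeWalk (T.act g u) (T.act g v) (T.adj_act g u v h)).support =
      (edgeWalk u v h).support.map (fun x => T'.act g x)

/-- `H` is bi-elliptic in `T`: it fixes two distinct points. -/
def BiElliptic (T : GTree G) (H : Subgroup G) : Prop :=
  ∃ u v : T.V, u ≠ v ∧ ∀ h ∈ H, T.act h u = u ∧ T.act h v = v

/-- `H` is a generalized edge group of `T`: it is squeezed between two edge stabilizers. -/
def GenEdgeGroup (T : GTree G) (H : Subgroup G) : Prop :=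
  ∃ u v u' v' : T.V, T.graph.Adj u v ∧ T.graph.Adj u' v' ∧
    T.edgeStab u v ≤ H ∧ H ≤ T.edgeStab u' v'

/-- `H` belongs to `𝒜_min` (relative to the deformation space of `T₀`): it fixes an edge
in every tree of the deformation space. -/
def Amin (T₀ : GTree G) (H : Subgroup G) : Prop :=
  ∀ T : GTree G, SameDef T₀ T → ∃ u v : T.V, T.graph.Adj u v ∧ H ≤ T.edgeStab u v

/-- A maximal elliptic subgroup (of the deformation space of `T₀`). -/
def MaxElliptic (T₀ : GTree G) (H : Subgroup G) : Prop :=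
  T₀.Elliptic H ∧ ∀ K : Subgroup G, T₀.Elliptic K → H ≤ K → K = H

end Morphisms

section OutG

variable (G : Type u) [Group G]

instance innRange_normal : ((MulAut.conj : G →* MulAut G).range).Normal := by
  constructor
  intro a ha φ
  obtain ⟨g, rfl⟩ := ha
  refine ⟨φ g, ?_⟩
  ext x
  simp only [MulAut.mul_apply, MulAut.conj_apply, map_mul, map_inv]
  simp [MulAut.inv_def]

/-- The outer automorphism group of `G`. -/
def OutG := MulAut G ⧸ (MulAut.conj : G →* MulAut G).range

noncomputable instance : Group (OutG G) := QuotientGroup.Quotient.group _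

/-- The class of an automorphism in `Out(G)`. -/
def toOutG (φ : MulAut G) : OutG G := QuotientGroup.mk φ

end OutG
section RealTrees

variable (G : Type u) [Group G]

/-- A non-trivial minimal `ℝ`-tree with an isometric action of `G`: a geodesic metric
space in which any two points are joined by a unique arc. -/
structure RGTree : Type (u + 1) where
  X : Type u
  [ms : MetricSpace X]
  nontrivial : Nontrivial X
  geodesic : ∀ x y : X, ∃ f : ℝ → X, f 0 = x ∧ f (dist x y) = y ∧
    ∀ s ∈ Set.Icc (0 : ℝ) (dist x y), ∀ t ∈ Set.Icc (0 : ℝ) (dist x y),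
      dist (f s) (f t) = |s - t|
  unique_arc : ∀ (x y : X) (γ : Set.Icc (0 : ℝ) 1 → X), Continuous γ →
    Function.Injective γ → γ ⟨0, by constructor <;> norm_num⟩ = x →
    γ ⟨1, by constructor <;> norm_num⟩ = y →
    ∀ z ∈ Set.range γ, dist x z + dist z y = dist x y
  act : G →* Equiv.Perm X
  isom : ∀ g : G, Isometry (act g)
  minimal : ∀ S : Set X, S.Nonempty → (∀ (g : G), ∀ x ∈ S, act g x ∈ S) →
    (∀ x ∈ S, ∀ y ∈ S, ∀ z : X, dist x z + dist z y = dist x y → z ∈ S) →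
    S = Set.univ

attribute [instance] RGTree.ms

variable {G}

namespace RGTree

variable (R : RGTree G)

/-- `z` lies between `x` and `y` (i.e. on the arc from `x` to `y`). -/
def Btw (x z y : R.X) : Prop := dist x z + dist z y = dist x y

/-- A subgroup is elliptic if it fixes a point. -/
def Elliptic (H : Subgroup G) : Prop := ∃ x : R.X, ∀ h ∈ H, R.act h x = x

/-- A hyperbolic element fixes no point. -/
def Hyperbolic (g : G) : Prop := ∀ x : R.X, R.act g x ≠ x

/-- The translation length of `g`. -/
noncomputable def ell (g : G) : ℝ :=
  sInf {r : ℝ | ∃ x : R.X, r = dist x (R.act g x)}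

/-- The characteristic set of `g`: its axis if `g` is hyperbolic, its fixed point set
if `g` is elliptic. -/
def Axis (g : G) : Set R.X := {x : R.X | dist x (R.act g x) = R.ell g}

/-- The fixed point set of `g`. -/
def Fix (g : G) : Set R.X := {x : R.X | R.act g x = x}

/-- The fixed point set of a subgroup. -/
def FixSub (H : Subgroup G) : Set R.X := {x : R.X | ∀ h ∈ H, R.act h x = x}

/-- Irreducibility: two hyperbolic elements with disjoint characteristic sets. -/
def Irr : Prop :=
  ∃ g h : G, R.Hyperbolic g ∧ R.Hyperbolic h ∧ R.Axis g ∩ R.Axis h = ∅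

/-- The distance between the characteristic sets of `g` and `h`. -/
noncomputable def axesDist (g h : G) : ℝ :=
  sInf {r : ℝ | ∃ x ∈ R.Axis g, ∃ y ∈ R.Axis h, r = dist x y}

end RGTree

/-- `f` realizes the metric simplicial `G`-tree `T` inside the `ℝ`-tree `R`. -/
def IsRealizationMap (R : RGTree G) (T : MGTree G) (f : T.V → R.X) : Prop :=
  (∀ (g : G) (v : T.V), f (T.act g v) = R.act g (f v)) ∧
  (∀ u v : T.V, dist (f u) (f v) = T.dist u v) ∧
  ∀ x : R.X, ∃ u v : T.V, T.graph.Adj u v ∧ R.Btw (f u) x (f v)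

/-- The `ℝ`-tree `R` is (equivariantly isometric to) the geometric realization of the
metric simplicial `G`-tree `T`. -/
def RealizationOf (R : RGTree G) (T : MGTree G) : Prop := ∃ f : T.V → R.X, IsRealizationMap R T f

variable (G)

/-- The equivariant Gromov–Hausdorff topology on the space of `ℝ`-trees. -/
noncomputable def gromovTopR : TopologicalSpace (RGTree G) where
  IsOpen U := ∀ R ∈ U, ∃ (X : Finset R.X) (A : Finset G) (ε : ℝ), 0 < ε ∧
    {R' : RGTree G | ∃ f : R.X → R'.X, ∀ x ∈ X, ∀ y ∈ X, ∀ g ∈ A,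
      |dist x (R.act g y) - dist (f x) (R'.act g (f y))| < ε} ⊆ U
  isOpen_univ := fun R _ => ⟨∅, ∅, 1, one_pos, Set.subset_univ _⟩
  isOpen_inter := by
    intro U V hU hV R hR
    obtain ⟨X₁, A₁, ε₁, hε₁, h₁⟩ := hU R hR.1
    obtain ⟨X₂, A₂, ε₂, hε₂, h₂⟩ := hV R hR.2
    refine ⟨X₁ ∪ X₂, A₁ ∪ A₂, min ε₁ ε₂, lt_min hε₁ hε₂, ?_⟩
    rintro R' ⟨f, hf⟩
    constructor
    · exact h₁ ⟨f, fun x hx y hy g hg =>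
        lt_of_lt_of_le (hf x (Finset.mem_union_left _ hx) y (Finset.mem_union_left _ hy) g
          (Finset.mem_union_left _ hg)) (min_le_left _ _)⟩
    · exact h₂ ⟨f, fun x hx y hy g hg =>
        lt_of_lt_of_le (hf x (Finset.mem_union_right _ hx) y (Finset.mem_union_right _ hy) g
          (Finset.mem_union_right _ hg)) (min_le_right _ _)⟩
  isOpen_sUnion := by
    intro s hs R hR
    obtain ⟨U, hUs, hRU⟩ := hR
    obtain ⟨X, A, ε, hε, h⟩ := hs U hUs R hRU
    exact ⟨X, A, ε, hε, h.trans (Set.subset_sUnion_of_mem hUs)⟩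

/-- The axes topology: the coarsest topology making all translation length functions
continuous. -/
noncomputable def axesTopR : TopologicalSpace (RGTree G) :=
  TopologicalSpace.induced (fun (R : RGTree G) (g : G) => R.ell g) Pi.topologicalSpace

variable {G}

/-- A morphism of `ℝ`-trees: an equivariant map such that every segment is a finite union
of subsegments on each of which the map is isometric. -/
structure RMorphism (R S : RGTree G) where
  f : R.X → S.X
  equivariant : ∀ (g : G) (x : R.X), f (R.act g x) = S.act g (f x)
  piecewise : ∀ x y : R.X, ∃ (n : ℕ) (c : Fin (n + 1) → R.X),
    c 0 = x ∧ c (Fin.last n) = y ∧ (∀ i : Fin (n + 1), R.Btw x (c i) y) ∧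
    ∀ i : Fin n, ∀ p q : R.X, R.Btw (c i.castSucc) p (c i.succ) →
      R.Btw (c i.castSucc) q (c i.succ) → dist (f p) (f q) = dist p q

/-- `M` is the intermediate tree at time `t` of Skora's deformation of the morphism `φ`:
the quotient of the source in which `x` and `y` are identified exactly when `φ` maps the
segment `[x,y]` into the ball of radius `t` around `φ(x) = φ(y)`. -/
def IsSkoraIntermediate {R S : RGTree G} (φ : RMorphism R S) (t : ℝ) (M : RGTree G) : Prop :=
  ∃ (p : R.X → M.X) (q : M.X → S.X), Function.Surjective p ∧
    (∀ (g : G) (x : R.X), p (R.act g x) = M.act g (p x)) ∧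
    (∀ (g : G) (m : M.X), q (M.act g m) = S.act g (q m)) ∧
    (∀ x : R.X, q (p x) = φ.f x) ∧
    (∀ x y : R.X, dist (p x) (p y) ≤ dist x y) ∧
    (∀ m m' : M.X, dist (q m) (q m') ≤ dist m m') ∧
    ∀ x y : R.X, p x = p y ↔ (φ.f x = φ.f y ∧
      ∀ z : R.X, R.Btw x z y → dist (φ.f z) (φ.f x) ≤ t)

/-- `P` is the basepoint of `R` determined by `g` and `h` (the endpoint of the
intersection of the two characteristic sets, resp. the projection of one onto the other),
characterized by the metric system (1) of [Guirardel–Levitt]. -/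
noncomputable def IsBasepoint (R : RGTree G) (g h : G) (P : R.X) : Prop :=
  dist P (R.act g P) = R.ell g ∧
  dist P (R.act h P) = R.ell h + 2 * R.axesDist g h ∧
  dist (R.act g P) (R.act h P) = R.ell g + R.ell h + 2 * R.axesDist g h ∧
  dist (R.act g P) (R.act h⁻¹ P) = R.ell g + R.ell h + 2 * R.axesDist g h

/-- `p` is a projection of `x` to the set `S` (a closest point of `S`). -/
def IsProj (R : RGTree G) (x : R.X) (S : Set R.X) (p : R.X) : Prop :=
  p ∈ S ∧ ∀ q ∈ S, dist x p ≤ dist x q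

/-- Equivariant isometry of `ℝ`-trees. -/
def RIsom (R R' : RGTree G) : Prop :=
  ∃ e : R.X ≃ R'.X, (∀ (g : G) (x : R.X), e (R.act g x) = R'.act g (e x)) ∧
    ∀ x y : R.X, dist (e x) (e y) = dist x y

/-- Equivariant homothety of `ℝ`-trees, with ratio `c`. -/
def RHomothety (c : ℝ) (R R' : RGTree G) : Prop :=
  ∃ e : R.X ≃ R'.X, (∀ (g : G) (x : R.X), e (R.act g x) = R'.act g (e x)) ∧
    ∀ x y : R.X, dist (e x) (e y) = c * dist x y

end RealTrees
section MoreDefs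

variable {G : Type u} [Group G]

/-- `H` is contained in a conjugate of `K`. -/
def ConjLe (H K : Subgroup G) : Prop := ∃ g : G, ∀ h ∈ H, g * h * g⁻¹ ∈ K

/-- `H` represents a maximal element of the vertical set `ℳ` associated to the
deformation space of `T₀`. -/
def MaxVert (T₀ : GTree G) (H : Subgroup G) : Prop :=
  T₀.Elliptic H ∧ ∀ K : Subgroup G, T₀.Elliptic K → ConjLe H K → ConjLe K H

/-- The vertical set `ℳ`: equivalence classes of maximal elements for containment in a
conjugate, among elliptic subgroups. -/
def vertSet (T₀ : GTree G) : Type u :=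
  Quot (fun H K : {H : Subgroup G // MaxVert T₀ H} => ConjLe H.1 K.1 ∧ ConjLe K.1 H.1)

namespace GTree

variable (T : GTree G)

/-- The set of `G`-orbits of vertices (the vertices of the quotient graph `T/G`). -/
def vertexOrbits : Type u := Quot (fun u v : T.V => ∃ g : G, T.act g u = v)

/-- Orbits of neighbours of `v` under the stabilizer of `v`: the oriented edges of the
quotient graph of groups issued from the image of `v`, whose number is the valence of
the image of `v`. -/
def nbrOrbits (v : T.V) : Type u :=
  Quot (fun a b : {w : T.V // T.graph.Adj v w} => ∃ g : G, T.act g v = v ∧ T.act g a.1 = b.1)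

/-- The set of `G`-orbits of (non-oriented) edges. -/
def edgeOrbits : Type u :=
  Quot (fun d d' : T.graph.Dart => ∃ g : G, T.dartAct g d = d' ∨ T.dartAct g d = d'.symm)

/-- BF-reduced: if an edge-to-vertex inclusion `G_e → G_u` is onto, then the image of `u`
in the quotient graph has valence at least 3. -/
def BFReduced : Prop :=
  ∀ u w : T.V, T.graph.Adj u w → T.stab u ≤ T.stab w →
    3 ≤ Cardinal.mk (T.nbrOrbits u)

end GTree

/-- The quotient graph of groups of `T` has a strict ascending loop: an edge whose
endpoints are in the same orbit, exactly one of the two edge-to-vertex inclusions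
being onto. -/
def HasSAL (T : GTree G) : Prop :=
  ∃ u v : T.V, T.graph.Adj u v ∧ (∃ g : G, T.act g u = v) ∧
    Xor' (T.stab u ≤ T.stab v) (T.stab v ≤ T.stab u)

/-- The edge (orbit of) `uv` is a surviving edge: `T` can be made reduced by a collapse
(within its deformation space) not collapsing `uv`. -/
def Surviving (T : GTree G) (u v : T.V) : Prop :=
  ∃ (T' : GTree G) (c : T.V → T'.V), IsCollapseMap T T' c ∧ SameDef T T' ∧
    T'.Reduced ∧ c u ≠ c v

/-- Containment in a conjugate by an element of `G₀`. -/
def perLe (G₀ : Subgroup G) (H K : Subgroup G) : Prop :=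
  ∃ g ∈ G₀, ∀ h ∈ H, g * h * g⁻¹ ∈ K

/-- `H` represents a maximal element of the peripheral structure `ℳ₀` of `G₀`. -/
def PeriphMax (T₀ : GTree G) (G₀ : Subgroup G) (H : Subgroup G) : Prop :=
  H ≤ G₀ ∧ Amin T₀ H ∧
    ∀ K : Subgroup G, K ≤ G₀ → Amin T₀ K → perLe G₀ H K → perLe G₀ K H

/-- The peripheral structure `ℳ₀` of `G₀`, as a set of equivalence classes. -/
def periphSet (T₀ : GTree G) (G₀ : Subgroup G) : Type u :=
  Quot (fun H K : {H : Subgroup G // PeriphMax T₀ G₀ H} =>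
    perLe G₀ H.1 K.1 ∧ perLe G₀ K.1 H.1)

end MoreDefs
section HelperBasics

variable {G : Type u} [Group G]

theorem hlp_quot_eq {α : Type*} {r : α → α → Prop} (hr : Equivalence r) {a b : α}
    (h : Quot.mk r a = Quot.mk r b) : r a b :=
  hr.eqvGen_iff.1 (Quot.eqvGen_exact h)

theorem GTree.act_mul_apply (T : GTree G) (g h : G) (x : T.V) :
    T.act (g * h) x = T.act g (T.act h x) := by
  rw [map_mul, Equiv.Perm.mul_apply]

theorem GTree.act_one_apply (T : GTree G) (x : T.V) : T.act 1 x = x := by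
  rw [map_one, Equiv.Perm.one_apply]

theorem GTree.act_inv_act (T : GTree G) (g : G) (x : T.V) : T.act g⁻¹ (T.act g x) = x := by
  rw [← T.act_mul_apply, inv_mul_cancel, T.act_one_apply]

theorem GTree.act_act_inv (T : GTree G) (g : G) (x : T.V) : T.act g (T.act g⁻¹ x) = x := by
  rw [← T.act_mul_apply, mul_inv_cancel, T.act_one_apply]

theorem GTree.mem_stab (T : GTree G) (g : G) (x : T.V) : g ∈ T.stab x ↔ T.act g x = x := Iff.rfl

theorem GTree.mem_edgeStab (T : GTree G) (g : G) (x y : T.V) :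
    g ∈ T.edgeStab x y ↔ T.act g x = x ∧ T.act g y = y := Iff.rfl

/-- In a tree, a path is contained in every walk with the same endpoints. -/
theorem hlp_path_subset {V : Type*} {Γ : SimpleGraph V} (hΓ : Γ.IsAcyclic) {u w : V}
    (p q : Γ.Walk u w) (hp : p.IsPath) : p.support ⊆ q.support := by
  have h : (⟨p, hp⟩ : Γ.Path u w) = ⟨q.bypass, q.bypass_isPath⟩ := hΓ.path_unique _ _
  have h' : p = q.bypass := congrArg Subtype.val h
  rw [h']
  exact q.support_bypass_subset_support

/-- The action of an element as a graph homomorphism. -/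
def GTree.actHom (T : GTree G) (g : G) : T.graph →g T.graph where
  toFun := T.act g
  map_rel' := fun {a b} h => T.adj_act g a b h

/-- If `g` fixes the endpoints of a path it fixes all vertices of the path. -/
theorem GTree.fix_path (T : GTree G) (g : G) {u w : T.V} (p : T.graph.Walk u w) (hp : p.IsPath)
    (hu : T.act g u = u) (hw : T.act g w = w) : ∀ x ∈ p.support, T.act g x = x := by
  replace hu : T.actHom g u = u := hu
  replace hw : T.actHom g w = w := hw
  have hinj : Function.Injective (T.actHom g) := (T.act g).injective
  have h1 : (p.map (T.actHom g)).IsPath := SimpleGraph.Walk.map_isPath_of_injective hinj hp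
  have h2 : ((p.map (T.actHom g)).copy hu hw).IsPath := by simpa using h1
  have h3 : (p.map (T.actHom g)).copy hu hw = p :=
    congrArg Subtype.val (T.isTree.isAcyclic.path_unique ⟨_, h2⟩ ⟨p, hp⟩)
  have h4 : p.support.map (T.act g) = p.support := by
    have := congrArg SimpleGraph.Walk.support h3
    rw [SimpleGraph.Walk.support_copy, SimpleGraph.Walk.support_map] at this
    exact this
  intro x hx
  obtain ⟨n, hn, rfl⟩ := List.getElem_of_mem hx
  have := List.getElem_map (T.act g) (l := p.support) (i := n) (h := by simpa using hn)
  rw [← this]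
  simp only [h4]

/-- A subgroup fixing `v` and another vertex fixes an edge at `v`. -/
theorem GTree.fix_nbr (T : GTree G) (H : Subgroup G) (v a : T.V) (hva : v ≠ a)
    (hv : H ≤ T.stab v) (ha : H ≤ T.stab a) :
    ∃ w, T.graph.Adj v w ∧ H ≤ T.edgeStab v w := by
  obtain ⟨p, hp⟩ := (T.isTree.existsUnique_path v a).exists
  have hnil : ¬ p.Nil := fun h => hva h.eq
  refine ⟨p.snd, p.adj_snd hnil, fun h hh => ⟨hv hh, ?_⟩⟩
  exact T.fix_path h p hp (hv hh) (ha hh) _ (p.getVert_mem_support 1)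

theorem hlp_nbr_equiv (T : GTree G) (v : T.V) :
    Equivalence (fun a b : {w : T.V // T.graph.Adj v w} =>
      ∃ g : G, T.act g v = v ∧ T.act g a.1 = b.1) where
  refl a := ⟨1, T.act_one_apply _, T.act_one_apply _⟩
  symm := by
    rintro a b ⟨g, h1, h2⟩
    refine ⟨g⁻¹, ?_, ?_⟩
    · conv_lhs => rw [← h1]
      rw [T.act_inv_act]
    · rw [← h2, T.act_inv_act]
  trans := by
    rintro a b c ⟨g, h1, h2⟩ ⟨k, h3, h4⟩
    exact ⟨k * g, by rw [T.act_mul_apply, h1, h3], by rw [T.act_mul_apply, h2, h4]⟩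

theorem perLe_refl (G₀ H : Subgroup G) : perLe G₀ H H :=
  ⟨1, G₀.one_mem, fun h hh => by simpa using hh⟩

theorem perLe_of_le (G₀ : Subgroup G) {H K : Subgroup G} (h : H ≤ K) : perLe G₀ H K :=
  ⟨1, G₀.one_mem, fun x hx => by simpa using h hx⟩

theorem perLe_trans {G₀ H K L : Subgroup G} (h1 : perLe G₀ H K) (h2 : perLe G₀ K L) :
    perLe G₀ H L := by
  obtain ⟨g, hg, h1⟩ := h1
  obtain ⟨k, hk, h2⟩ := h2
  refine ⟨k * g, G₀.mul_mem hk hg, fun x hx => ?_⟩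
  have := h2 _ (h1 x hx)
  have e : k * g * x * (k * g)⁻¹ = k * (g * x * g⁻¹) * k⁻¹ := by group
  rw [e]; exact this

theorem hlp_periph_equiv (T₀ : GTree G) (G₀ : Subgroup G) :
    Equivalence (fun H K : {H : Subgroup G // PeriphMax T₀ G₀ H} =>
      perLe G₀ H.1 K.1 ∧ perLe G₀ K.1 H.1) where
  refl a := ⟨perLe_refl _ _, perLe_refl _ _⟩
  symm h := ⟨h.2, h.1⟩
  trans h k := ⟨perLe_trans h.1 k.1, perLe_trans k.2 h.2⟩

theorem Amin_mono (T₀ : GTree G) {H K : Subgroup G} (hHK : H ≤ K) (hK : Amin T₀ K) :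
    Amin T₀ H := by
  intro T hT
  obtain ⟨u, v, h1, h2⟩ := hK T hT
  exact ⟨u, v, h1, hHK.trans h2⟩

/-- If `g` fixes `v` and `g a = b` then the edge group of `va` is conjugate into that of `vb`. -/
theorem GTree.perLe_edge (T : GTree G) (v a b : T.V) (g : G) (hg : T.act g v = v)
    (hab : T.act g a = b) : perLe (T.stab v) (T.edgeStab v a) (T.edgeStab v b) := by
  refine ⟨g, hg, fun h hh => ?_⟩
  rw [T.mem_edgeStab] at hh ⊢
  have hgi : T.act g⁻¹ v = v := (T.stab v).inv_mem hg
  constructor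
  · rw [T.act_mul_apply, T.act_mul_apply, hgi, hh.1, hg]
  · rw [T.act_mul_apply, T.act_mul_apply, ← hab, T.act_inv_act, hh.2]

/-- Finiteness of the valence. -/
theorem GTree.finite_nbrOrbits [Group.FG G] (T : GTree G) (v : T.V) : Finite (T.nbrOrbits v) := by
  obtain ⟨A, hA⟩ := (Group.fg_def.1 (inferInstance : Group.FG G))
  have hpath : ∀ a : G, ∃ p : T.graph.Walk v (T.act a v), p.IsPath := fun a =>
    (T.isTree.existsUnique_path v (T.act a v)).exists
  choose p hp using hpath
  let F : Set T.V := ⋃ a ∈ A, {x | x ∈ (p a).support}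
  have hF : F.Finite := A.finite_toSet.biUnion fun a _ => List.finite_toSet _
  let Gd : SimpleGraph T.V :=
    { Adj := fun a b => T.graph.Adj a b ∧ ∃ g : G, ∃ c ∈ F, ∃ d ∈ F, T.act g c = a ∧ T.act g d = b
      symm := ⟨by
        rintro a b ⟨h, g, c, hc, d, hd, h1, h2⟩
        exact ⟨h.symm, g, d, hd, c, hc, h2, h1⟩⟩
      loopless := ⟨fun a h => h.1.ne rfl⟩ }
  have hle : Gd ≤ T.graph := fun a b h => h.1
  let gHom : G → (Gd →g Gd) := fun g =>
    { toFun := T.act g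
      map_rel' := by
        rintro a b ⟨h, k, c, hc, d, hd, h1, h2⟩
        exact ⟨T.adj_act g a b h, g * k, c, hc, d, hd, by rw [T.act_mul_apply, h1],
          by rw [T.act_mul_apply, h2]⟩ }
  have hmap : ∀ (g : G) (x y : T.V), Gd.Reachable x y → Gd.Reachable (T.act g x) (T.act g y) :=
    fun g x y h => h.map (gHom g)
  have hgen : ∀ a ∈ A, Gd.Reachable v (T.act a v) := by
    intro a ha
    refine ⟨(p a).transfer Gd ?_⟩
    intro e he
    induction e with
    | h c d =>
      refine ⟨(p a).adj_of_mem_edges he, 1, c, ?_, d, ?_, T.act_one_apply _, T.act_one_apply _⟩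
      · exact Set.mem_biUnion ha ((p a).fst_mem_support_of_mem_edges he)
      · exact Set.mem_biUnion ha ((p a).snd_mem_support_of_mem_edges he)
  have hall : ∀ g : G, Gd.Reachable v (T.act g v) := by
    intro g
    have hg : g ∈ Subgroup.closure (A : Set G) := by rw [hA]; trivial
    induction hg using Subgroup.closure_induction with
    | mem a ha => exact hgen a ha
    | one => rw [T.act_one_apply]
    | mul a b _ _ ha hb =>
      rw [T.act_mul_apply]
      exact ha.trans (hmap a _ _ hb)
    | inv a _ ha =>
      have := hmap a⁻¹ _ _ ha
      rw [T.act_inv_act] at this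
      exact this.symm
  have huniv : {x | Gd.Reachable v x} = Set.univ := by
    apply T.minimal
    · exact ⟨v, SimpleGraph.Reachable.refl _⟩
    · intro g x hx
      exact (hall g).trans (hmap g _ _ hx)
    · intro a ha b hb q hq w hw
      have hab : Gd.Reachable a b := (SimpleGraph.Reachable.symm ha).trans hb
      obtain ⟨r⟩ := hab
      have hsub := hlp_path_subset T.isTree.isAcyclic q (r.mapLe hle) hq hw
      rw [SimpleGraph.Walk.support_mapLe_eq_support] at hsub
      exact SimpleGraph.Reachable.trans ha ⟨r.takeUntil w hsub⟩
  have hedge : ∀ w, T.graph.Adj v w → Gd.Adj v w := by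
    intro w hw
    by_contra hcon
    have hr : Gd.Reachable v w := by
      have : w ∈ {x | Gd.Reachable v x} := by rw [huniv]; trivial
      exact this
    have hb := (SimpleGraph.isAcyclic_iff_forall_adj_isBridge.1 T.isTree.isAcyclic) hw
    rw [SimpleGraph.isBridge_iff_forall_walk_mem_edges] at hb
    obtain ⟨r⟩ := hr
    have := hb (r.mapLe hle)
    rw [SimpleGraph.Walk.edges_mapLe_eq_edges] at this
    exact hcon (r.adj_of_mem_edges this)
  have hfin : Finite (F × F) := by
    have := hF.to_subtype
    infer_instance
  have hch : ∀ q : T.nbrOrbits v, ∃ z : F × F, ∃ w : {w : T.V // T.graph.Adj v w}, ∃ g : G,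
      q = Quot.mk _ w ∧ T.act g z.1.1 = v ∧ T.act g z.2.1 = w.1 := by
    intro q
    induction q using Quot.ind with
    | mk w =>
      obtain ⟨_, g, c, hc, d, hd, h1, h2⟩ := hedge w.1 w.2
      exact ⟨(⟨c, hc⟩, ⟨d, hd⟩), w, g, rfl, h1, h2⟩
  choose z w g h1 h2 h3 using hch
  refine Finite.of_injective z ?_
  intro q q' hqq
  rw [h1 q, h1 q']
  apply Quot.sound
  refine ⟨g q' * (g q)⁻¹, ?_, ?_⟩
  · rw [T.act_mul_apply]
    conv_lhs => rw [← h2 q]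
    rw [T.act_inv_act, hqq, h2 q']
  · rw [T.act_mul_apply, ← h3 q, T.act_inv_act, hqq, h3 q']

end HelperBasics
section HelperExpansion

variable {G : Type u} [Group G]

/-- A graph with a height function such that adjacent vertices have distinct heights, and each
vertex has at most one lower neighbour, is acyclic. -/
theorem hlp_acyclic_of_height {V : Type*} (Γ : SimpleGraph V) (h : V → ℕ)
    (hne : ∀ a b, Γ.Adj a b → h a ≠ h b)
    (huniq : ∀ a b c, Γ.Adj a b → Γ.Adj a c → h b < h a → h c < h a → b = c) : Γ.IsAcyclic := by
  intro x c hc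
  obtain ⟨m, hm, hmax⟩ : ∃ m ∈ c.support, ∀ y ∈ c.support, h y ≤ h m := by
    obtain ⟨m, hm, hmax⟩ := c.support.toFinset.exists_max_image h ⟨x, by simp⟩
    exact ⟨m, by simpa using hm, fun y hy => hmax y (by simpa using hy)⟩
  have hc' := hc.rotate hm
  have hmem : ∀ y, y ∈ (c.rotate m hm).support → h y ≤ h m := fun y hy =>
    hmax y ((SimpleGraph.Walk.mem_support_rotate_iff c m hm).1 hy)
  have hnil := hc'.not_nil
  have a1 := (c.rotate m hm).adj_snd hnil
  have a2 := (c.rotate m hm).adj_penultimate hnil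
  refine hc'.snd_ne_penultimate (huniq m _ _ a1 a2.symm ?_ ?_)
  · exact lt_of_le_of_ne (hmem _ (SimpleGraph.Walk.getVert_mem_support _ _)) (hne _ _ a1).symm
  · exact lt_of_le_of_ne (hmem _ (SimpleGraph.Walk.getVert_mem_support _ _)) (hne _ _ a2)

/-- In a tree, there is at most one neighbour closer to the root. -/
theorem hlp_parent_unique {V : Type*} {Γ : SimpleGraph V} (hΓ : Γ.IsTree) (r a b c : V)
    (hb : Γ.Adj a b) (hc : Γ.Adj a c) (h1 : Γ.dist r b < Γ.dist r a)
    (h2 : Γ.dist r c < Γ.dist r a) : b = c := by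
  have key : ∀ b, Γ.Adj a b → Γ.dist r b < Γ.dist r a →
      ∃ (p : Γ.Walk r a), p.IsPath ∧ p.penultimate = b := by
    intro b hb h1
    obtain ⟨p, hp, hl⟩ := (hΓ.connected r b).exists_path_of_dist
    have hd := hΓ.dist_eq_dist_add_one_of_adj r hb
    refine ⟨p.concat hb.symm, ?_, by simp⟩
    apply SimpleGraph.Walk.isPath_of_length_eq_dist
    rw [SimpleGraph.Walk.length_concat, hl]
    omega
  obtain ⟨p, hp, rfl⟩ := key b hb h1
  obtain ⟨q, hq, rfl⟩ := key c hc h2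
  have : p = q := congrArg Subtype.val (hΓ.isAcyclic.path_unique ⟨p, hp⟩ ⟨q, hq⟩)
  rw [this]

/-- Data for an expansion of `T`: new vertices `N`, each attached to an old vertex `src n`,
and for each oriented edge `ab` the new origin `e a b` of that edge. -/
structure ExpData (T : GTree G) where
  N : Type u
  nact : G →* Equiv.Perm N
  src : N → T.V
  src_act : ∀ (g : G) (n : N), src (nact g n) = T.act g (src n)
  e : T.V → T.V → T.V ⊕ N
  e_src : ∀ a b, T.graph.Adj a b → Sum.elim id src (e a b) = a
  e_act : ∀ (g : G) (a b : T.V), T.graph.Adj a b →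
    e (T.act g a) (T.act g b) = Sum.map (T.act g) (nact g) (e a b)
  e_inl : ∀ a b, T.graph.Adj a b → e a b = Sum.inl a → ∀ n, src n ≠ a
  e_surj : ∀ n, ∃ b, T.graph.Adj (src n) b ∧ e (src n) b = Sum.inr n
  moved : ∀ n, ∃ g : G, T.act g (src n) = src n ∧ nact g n ≠ n

namespace ExpData

variable {T : GTree G} (E : ExpData T)

/-- The collapse map. -/
def c : T.V ⊕ E.N → T.V := Sum.elim id E.src

@[simp] theorem c_inl (a : T.V) : E.c (Sum.inl a) = a := rfl
@[simp] theorem c_inr (n : E.N) : E.c (Sum.inr n) = E.src n := rfl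

theorem c_e (a b : T.V) (h : T.graph.Adj a b) : E.c (E.e a b) = a := E.e_src a b h

/-- Adjacency in the expanded tree. -/
inductive NAdj : T.V ⊕ E.N → T.V ⊕ E.N → Prop
  | up (n : E.N) : NAdj (Sum.inl (E.src n)) (Sum.inr n)
  | down (n : E.N) : NAdj (Sum.inr n) (Sum.inl (E.src n))
  | old (a b : T.V) (h : T.graph.Adj a b) : NAdj (E.e a b) (E.e b a)

/-- The graph of the expanded tree. -/
def graph : SimpleGraph (T.V ⊕ E.N) where
  Adj := E.NAdj
  symm := ⟨by
    rintro _ _ (n | n | ⟨a, b, h⟩)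
    · exact NAdj.down n
    · exact NAdj.up n
    · exact NAdj.old b a h.symm⟩
  loopless := ⟨by
    intro x hx
    have key : ∀ x y, E.NAdj x y → x ≠ y := by
      rintro _ _ (n | n | ⟨a, b, h⟩)
      · simp
      · simp
      · intro hh
        have := congrArg E.c hh
        rw [E.c_e a b h, E.c_e b a h.symm] at this
        exact h.ne this
    exact key x x hx rfl⟩

/-- The action on the vertices of the expanded tree. -/
def act : G →* Equiv.Perm (T.V ⊕ E.N) where
  toFun g := Equiv.sumCongr (T.act g) (E.nact g)
  map_one' := by ext x; cases x <;> simp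
  map_mul' g h := by ext x; cases x <;> simp

@[simp] theorem act_inl (g : G) (a : T.V) : E.act g (Sum.inl a) = Sum.inl (T.act g a) := rfl
@[simp] theorem act_inr (g : G) (n : E.N) : E.act g (Sum.inr n) = Sum.inr (E.nact g n) := rfl

theorem act_e (g : G) (a b : T.V) (h : T.graph.Adj a b) :
    E.act g (E.e a b) = E.e (T.act g a) (T.act g b) := by
  rw [E.e_act g a b h]
  cases E.e a b <;> rfl

theorem c_act (g : G) (x : T.V ⊕ E.N) : E.c (E.act g x) = T.act g (E.c x) := by
  cases x with
  | inl a => rfl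
  | inr n => exact E.src_act g n

theorem reach_c (x : T.V ⊕ E.N) : E.graph.Reachable x (Sum.inl (E.c x)) := by
  cases x with
  | inl a => exact SimpleGraph.Reachable.refl _
  | inr n => exact SimpleGraph.Adj.reachable (NAdj.down n)

theorem connected : E.graph.Connected := by
  have hadj : ∀ a b, T.graph.Adj a b → E.graph.Reachable (Sum.inl a) (Sum.inl b) := by
    intro a b h
    have h1 := E.reach_c (E.e a b)
    have h2 := E.reach_c (E.e b a)
    rw [E.c_e a b h] at h1
    rw [E.c_e b a h.symm] at h2
    have h3 : E.graph.Reachable (E.e a b) (E.e b a) := SimpleGraph.Adj.reachable (NAdj.old a b h)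
    exact h1.symm.trans (h3.trans h2)
  have hw : ∀ a b, T.graph.Walk a b → E.graph.Reachable (Sum.inl a) (Sum.inl b) := by
    intro a b p
    induction p with
    | nil => exact SimpleGraph.Reachable.refl _
    | cons h _ ih => exact (hadj _ _ h).trans ih
  obtain ⟨v⟩ := T.nonempty
  haveI : Nonempty (T.V ⊕ E.N) := ⟨Sum.inl v⟩
  refine ⟨fun x y => ?_⟩
  obtain ⟨p⟩ := T.isTree.connected (E.c x) (E.c y)
  exact (E.reach_c x).trans ((hw _ _ p).trans (E.reach_c y).symm)

theorem acyclic : E.graph.IsAcyclic := by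
  obtain ⟨r⟩ := T.nonempty
  let d : T.V → ℕ := fun a => T.graph.dist r a
  let Low : E.N → Prop := fun n => ∃ p, T.graph.Adj (E.src n) p ∧ d p < d (E.src n) ∧
    E.e (E.src n) p = Sum.inr n
  let h : T.V ⊕ E.N → ℕ := Sum.elim (fun a => 3 * d a + 1)
    (fun n => if Low n then 3 * d (E.src n) else 3 * d (E.src n) + 2)
  have hinl : ∀ a, h (Sum.inl a) = 3 * d a + 1 := fun a => rfl
  have hlow : ∀ n, Low n → h (Sum.inr n) = 3 * d (E.src n) := fun n hn => if_pos hn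
  have hhigh : ∀ n, ¬ Low n → h (Sum.inr n) = 3 * d (E.src n) + 2 := fun n hn => if_neg hn
  have hdadj : ∀ a b, T.graph.Adj a b → d a = d b + 1 ∨ d b = d a + 1 := by
    intro a b hab
    have := T.isTree.dist_eq_dist_add_one_of_adj r hab
    exact this
  -- height bounds
  have hbd : ∀ x, 3 * d (E.c x) ≤ h x ∧ h x ≤ 3 * d (E.c x) + 2 := by
    intro x
    cases x with
    | inl a => rw [hinl]; simp
    | inr n =>
      by_cases hn : Low n
      · rw [hlow n hn]; simp
      · rw [hhigh n hn]; simp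
  -- old edges
  have hold : ∀ a b, T.graph.Adj a b → (h (E.e b a) < h (E.e a b) ↔ d b < d a) := by
    intro a b hab
    have h1 := hbd (E.e a b)
    have h2 := hbd (E.e b a)
    rw [E.c_e a b hab] at h1
    rw [E.c_e b a hab.symm] at h2
    have := hdadj a b hab
    omega
  refine hlp_acyclic_of_height E.graph h ?_ ?_
  · rintro _ _ (n | n | ⟨a, b, hab⟩)
    · rw [hinl]
      by_cases hn : Low n
      · rw [hlow n hn]; omega
      · rw [hhigh n hn]; omega
    · rw [hinl]
      by_cases hn : Low n
      · rw [hlow n hn]; omega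
      · rw [hhigh n hn]; omega
    · have h1 := hold a b hab
      have h2 := hold b a hab.symm
      have := hdadj a b hab
      omega
  · -- characterise lower neighbours
    have hchar : ∀ x y, E.NAdj x y → h y < h x →
        (∃ n, x = Sum.inl (E.src n) ∧ y = Sum.inr n ∧ Low n) ∨
        (∃ n, x = Sum.inr n ∧ y = Sum.inl (E.src n) ∧ ¬ Low n) ∨
        (∃ a b, T.graph.Adj a b ∧ x = E.e a b ∧ y = E.e b a ∧ d b < d a) := by
      rintro _ _ (n | n | ⟨a, b, hab⟩) hlt
      · left
        refine ⟨n, rfl, rfl, ?_⟩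
        by_contra hn
        rw [hinl, hhigh n hn] at hlt
        omega
      · right; left
        refine ⟨n, rfl, rfl, ?_⟩
        intro hn
        rw [hinl, hlow n hn] at hlt
        omega
      · right; right
        exact ⟨a, b, hab, rfl, rfl, (hold a b hab).1 hlt⟩
    have hpar : ∀ a b c, T.graph.Adj a b → T.graph.Adj a c → d b < d a → d c < d a → b = c :=
      fun a b c => hlp_parent_unique T.isTree r a b c
    have c13 : ∀ n a b, T.graph.Adj a b → Sum.inl (E.src n) = E.e a b → False := by
      intro n a b hab hx
      have h1 := congrArg E.c hx
      rw [E.c_e a b hab, E.c_inl] at h1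
      rw [h1] at hx
      exact E.e_inl a b hab hx.symm n h1
    have c23 : ∀ n a b, T.graph.Adj a b → d b < d a → Sum.inr n = E.e a b → Low n := by
      intro n a b hab hd hx
      have h1 := congrArg E.c hx
      rw [E.c_e a b hab, E.c_inr] at h1
      subst h1
      exact ⟨b, hab, hd, hx.symm⟩
    intro x y z hxy hxz hy hz
    rcases hchar x y hxy hy with ⟨n, rfl, rfl, hn⟩ | ⟨n, rfl, rfl, hn⟩ | ⟨a, b, hab, rfl, rfl, hd⟩
    · rcases hchar _ z hxz hz with ⟨m, hx, rfl, hm⟩ | ⟨m, hx, rfl, hm⟩ | ⟨a, b, hab, hx, rfl, hd⟩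
      · have hs : E.src n = E.src m := Sum.inl.inj hx
        obtain ⟨p, p1, p2, p3⟩ := hn
        obtain ⟨q, q1, q2, q3⟩ := hm
        rw [← hs] at q1 q2 q3
        have := hpar _ _ _ p1 q1 p2 q2
        rw [← p3, ← q3, this]
      · cases hx
      · exact (c13 n a b hab hx).elim
    · rcases hchar _ z hxz hz with ⟨m, hx, rfl, hm⟩ | ⟨m, hx, rfl, hm⟩ | ⟨a, b, hab, hx, rfl, hd⟩
      · cases hx
      · have hs : n = m := Sum.inr.inj hx
        rw [hs]
      · exact (hn (c23 n a b hab hd hx)).elim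
    · rcases hchar _ z hxz hz with
        ⟨m, hx, rfl, hm⟩ | ⟨m, hx, rfl, hm⟩ | ⟨a', b', hab', hx, rfl, hd'⟩
      · exact (c13 m a b hab hx.symm).elim
      · exact (hm (c23 m a b hab hd hx.symm)).elim
      · have h1 := congrArg E.c hx
        rw [E.c_e a b hab, E.c_e a' b' hab'] at h1
        subst h1
        have := hpar _ _ _ hab hab' hd hd'
        rw [this]

theorem isTree : E.graph.IsTree := ⟨E.connected, E.acyclic⟩

/-- Walks in the expansion project to walks in `T` through the images. -/
theorem proj_walk {x y : T.V ⊕ E.N} (p : E.graph.Walk x y) :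
    ∃ q : T.graph.Walk (E.c x) (E.c y), ∀ a ∈ q.support, ∃ z ∈ p.support, E.c z = a := by
  induction p with
  | nil =>
    refine ⟨SimpleGraph.Walk.nil, fun a ha => ?_⟩
    rw [SimpleGraph.Walk.support_nil, List.mem_singleton] at ha
    exact ⟨_, by simp, ha.symm⟩
  | @cons x y z h p ih =>
    obtain ⟨q, hq⟩ := ih
    have hcase : E.c x = E.c y ∨ T.graph.Adj (E.c x) (E.c y) := by
      have key : ∀ x y, E.NAdj x y → (E.c x = E.c y ∨ T.graph.Adj (E.c x) (E.c y)) := by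
        rintro _ _ (n | n | ⟨a, b, hab⟩)
        · left; rfl
        · left; rfl
        · right; rw [E.c_e a b hab, E.c_e b a hab.symm]; exact hab
      exact key x y h
    rcases hcase with hc | hc
    · refine ⟨q.copy hc.symm rfl, fun a ha => ?_⟩
      rw [SimpleGraph.Walk.support_copy] at ha
      obtain ⟨w, hw, hwa⟩ := hq a ha
      exact ⟨w, by simp [hw], hwa⟩
    · refine ⟨SimpleGraph.Walk.cons hc q, fun a ha => ?_⟩
      rw [SimpleGraph.Walk.support_cons, List.mem_cons] at ha
      rcases ha with rfl | ha
      · exact ⟨x, by simp, rfl⟩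
      · obtain ⟨w, hw, hwa⟩ := hq a ha
        exact ⟨w, by simp [hw], hwa⟩

theorem minimal (S : Set (T.V ⊕ E.N)) (hS : S.Nonempty)
    (hinv : ∀ (g : G), ∀ x ∈ S, E.act g x ∈ S)
    (hconv : ∀ x ∈ S, ∀ y ∈ S, ∀ p : E.graph.Walk x y, p.IsPath → ∀ w ∈ p.support, w ∈ S) :
    S = Set.univ := by
  have himg : E.c '' S = Set.univ := by
    apply T.minimal
    · exact hS.image _
    · rintro g _ ⟨x, hx, rfl⟩
      exact ⟨E.act g x, hinv g x hx, E.c_act g x⟩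
    · rintro _ ⟨x, hx, rfl⟩ _ ⟨y, hy, rfl⟩ p hp w hw
      obtain ⟨q, hq, -⟩ := E.isTree.existsUnique_path x y
      obtain ⟨q', hq'⟩ := E.proj_walk q
      obtain ⟨z, hz, hzw⟩ := hq' w (hlp_path_subset T.isTree.isAcyclic p q' hp hw)
      exact ⟨z, hconv x hx y hy q hq z hz, hzw⟩
  have hinl : ∀ a, Sum.inl a ∈ S := by
    intro a
    have ha : a ∈ E.c '' S := by rw [himg]; trivial
    obtain ⟨x, hx, rfl⟩ := ha
    cases x with
    | inl a => exact hx
    | inr n =>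
      obtain ⟨g, hg1, hg2⟩ := E.moved n
      have hx' := hinv g _ hx
      rw [E.act_inr] at hx'
      have a1 : E.graph.Adj (Sum.inr n) (Sum.inl (E.src n)) := NAdj.down n
      have a2 : E.graph.Adj (Sum.inl (E.src n)) (Sum.inr (E.nact g n)) := by
        have : E.src (E.nact g n) = E.src n := by rw [E.src_act, hg1]
        rw [← this]
        exact NAdj.up _
      refine hconv _ hx _ hx' (SimpleGraph.Walk.cons a1 (SimpleGraph.Walk.cons a2 .nil)) ?_ _
        (by simp)
      simp [SimpleGraph.Walk.isPath_def, hg2.symm]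
  ext x
  refine ⟨fun _ => trivial, fun _ => ?_⟩
  cases x with
  | inl a => exact hinl a
  | inr n =>
    obtain ⟨b, hb, hbn⟩ := E.e_surj n
    have a1 : E.graph.Adj (Sum.inl (E.src n)) (Sum.inr n) := NAdj.up n
    have a2 : E.graph.Adj (Sum.inr n) (E.e b (E.src n)) := by
      rw [← hbn]
      exact NAdj.old _ _ hb
    have hcb := E.c_e b _ hb.symm
    generalize E.e b (E.src n) = z at a2 hcb
    cases z with
    | inl b' =>
      rw [E.c_inl] at hcb
      subst hcb
      refine hconv _ (hinl (E.src n)) _ (hinl b')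
        (SimpleGraph.Walk.cons a1 (SimpleGraph.Walk.cons a2 .nil)) ?_ _ (by simp)
      simp [SimpleGraph.Walk.isPath_def, hb.ne]
    | inr m =>
      rw [E.c_inr] at hcb
      subst hcb
      have a3 : E.graph.Adj (Sum.inr m) (Sum.inl (E.src m)) := NAdj.down m
      have hnm : n ≠ m := by
        rintro rfl
        exact hb.ne rfl
      refine hconv _ (hinl (E.src n)) _ (hinl (E.src m))
        (SimpleGraph.Walk.cons a1 (SimpleGraph.Walk.cons a2 (SimpleGraph.Walk.cons a3 .nil)))
        ?_ _ (by simp)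
      simp [SimpleGraph.Walk.isPath_def, hb.ne, hnm]

/-- The expanded `G`-tree. -/
def tree : GTree G where
  V := T.V ⊕ E.N
  nonempty := by
    obtain ⟨v⟩ := T.nonempty
    exact ⟨Sum.inl v⟩
  graph := E.graph
  isTree := E.isTree
  act := E.act
  adj_act := by
    rintro g _ _ (n | n | ⟨a, b, h⟩)
    · rw [E.act_inl, E.act_inr, ← E.src_act]
      exact NAdj.up _
    · rw [E.act_inl, E.act_inr, ← E.src_act]
      exact NAdj.down _
    · rw [E.act_e g a b h, E.act_e g b a h.symm]
      exact NAdj.old _ _ (T.adj_act g a b h)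
  noInversion := by
    rintro g _ _ (n | n | ⟨a, b, h⟩) ⟨h1, h2⟩
    · rw [E.act_inl] at h1
      cases h1
    · rw [E.act_inr] at h1
      cases h1
    · have h1' := congrArg E.c h1
      have h2' := congrArg E.c h2
      rw [E.c_act, E.c_e a b h, E.c_e b a h.symm] at h1'
      rw [E.c_act, E.c_e a b h, E.c_e b a h.symm] at h2'
      exact T.noInversion g a b h ⟨h1', h2'⟩
  minimal := E.minimal

theorem sameDef : SameDef T E.tree := by
  intro H
  constructor
  · rintro ⟨v, hv⟩
    refine ⟨(Sum.inl v : T.V ⊕ E.N), fun h hh => ?_⟩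
    exact congrArg Sum.inl (hv h hh)
  · rintro ⟨x, hx⟩
    refine ⟨E.c x, fun h hh => ?_⟩
    exact (E.c_act h x).symm.trans (congrArg E.c (hx h hh))

end ExpData

end HelperExpansion
section HelperMain

variable {G : Type u} [Group G]

/-- Equivariant choice. -/
theorem hlp_equivariant {X : Type*} (α : G →* Equiv.Perm X) (P : X → X → Prop)
    (hP : ∀ (g : G) (x y : X), P x y → P (α g x) (α g y))
    (hex : ∀ x, ∃ y, P x y ∧ ∀ g, α g x = x → α g y = y) :
    ∃ f : X → X, (∀ x, P x (f x)) ∧ ∀ (g : G) (x : X), f (α g x) = α g (f x) := by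
  have hmul : ∀ (g h : G) (x : X), α (g * h) x = α g (α h x) := fun g h x => by
    rw [map_mul, Equiv.Perm.mul_apply]
  have hone : ∀ x, α 1 x = x := fun x => by rw [map_one, Equiv.Perm.one_apply]
  have hinv : ∀ (g : G) (x : X), α g⁻¹ (α g x) = x := fun g x => by
    rw [← hmul, inv_mul_cancel, hone]
  have hinv' : ∀ (g : G) (x : X), α g (α g⁻¹ x) = x := fun g x => by
    rw [← hmul, mul_inv_cancel, hone]
  let r : X → X → Prop := fun x y => ∃ g, α g x = y
  have hr : Equivalence r :=
    ⟨fun x => ⟨1, hone x⟩, fun {x y} ⟨g, hg⟩ => ⟨g⁻¹, by rw [← hg, hinv]⟩,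
      fun {x y z} ⟨g, hg⟩ ⟨k, hk⟩ => ⟨k * g, by rw [hmul, hg, hk]⟩⟩
  choose y hy1 hy2 using hex
  let rep : X → X := fun x => (Quot.mk r x).out
  have hk : ∀ x, ∃ k, α k (rep x) = x := fun x => hlp_quot_eq hr (Quot.out_eq (Quot.mk r x))
  choose k hk using hk
  have hrep : ∀ g x, rep (α g x) = rep x := by
    intro g x
    have : Quot.mk r (α g x) = Quot.mk r x := (Quot.sound ⟨g, rfl⟩).symm
    simp only [rep, this]
  refine ⟨fun x => α (k x) (y (rep x)), fun x => ?_, fun g x => ?_⟩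
  · have := hP (k x) _ _ (hy1 (rep x))
    rwa [hk] at this
  · have h1 : α ((g * k x)⁻¹ * k (α g x)) (rep x) = rep x := by
      rw [hmul]
      have h2 := hk (α g x)
      rw [hrep] at h2
      rw [h2]
      have h5 : α g x = α (g * k x) (rep x) := by rw [hmul, hk]
      rw [h5, hinv]
    have h3 := hy2 _ _ h1
    rw [hmul] at h3
    have h4 := congrArg (α (g * k x)) h3
    rw [hinv', hmul] at h4
    show α (k (α g x)) (y (rep (α g x))) = α g (α (k x) (y (rep x)))
    rw [hrep, h4]

/-- The action on pairs of vertices. -/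
def GTree.pact (T : GTree G) : G →* Equiv.Perm (T.V × T.V) where
  toFun g := Equiv.prodCongr (T.act g) (T.act g)
  map_one' := by ext x <;> simp
  map_mul' g h := by ext x <;> simp

theorem GTree.pact_apply (T : GTree G) (g : G) (p : T.V × T.V) :
    T.pact g p = (T.act g p.1, T.act g p.2) := rfl

theorem GTree.pact_mul_apply (T : GTree G) (g h : G) (p : T.V × T.V) :
    T.pact (g * h) p = T.pact g (T.pact h p) := by
  rw [map_mul, Equiv.Perm.mul_apply]

theorem GTree.adj_act_iff (T : GTree G) (g : G) (a b : T.V) :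
    T.graph.Adj (T.act g a) (T.act g b) ↔ T.graph.Adj a b := by
  refine ⟨fun h => ?_, T.adj_act g a b⟩
  have := T.adj_act g⁻¹ _ _ h
  rwa [T.act_inv_act, T.act_inv_act] at this

/-- The set of pairs in the orbits of the pairs `(v, w m)`. -/
def GTree.orbSet (T : GTree G) (v : T.V) {M : Type*} (w : M → T.V) : Set (T.V × T.V) :=
  {p | ∃ m, ∃ g : G, p = (T.act g v, T.act g (w m))}

theorem GTree.orbSet_act (T : GTree G) (v : T.V) {M : Type*} (w : M → T.V) (g : G)
    (p : T.V × T.V) (hp : p ∈ T.orbSet v w) : T.pact g p ∈ T.orbSet v w := by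
  obtain ⟨m, k, rfl⟩ := hp
  exact ⟨m, g * k, by rw [T.pact_apply, T.act_mul_apply, T.act_mul_apply]⟩

theorem GTree.orbSet_act_iff (T : GTree G) (v : T.V) {M : Type*} (w : M → T.V) (g : G)
    (p : T.V × T.V) : T.pact g p ∈ T.orbSet v w ↔ p ∈ T.orbSet v w := by
  refine ⟨fun h => ?_, T.orbSet_act v w g p⟩
  have := T.orbSet_act v w g⁻¹ _ h
  rwa [← T.pact_mul_apply, inv_mul_cancel, map_one, Equiv.Perm.one_apply] at this

/-- The equivariant choice of the new origins of edges. -/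
theorem GTree.exists_retraction (T : GTree G) (v : T.V) {M : Type*} (w : M → T.V)
    (hdom : ∀ x, T.graph.Adj v x → ∃ m, ∃ k : G, T.act k v = v ∧
      T.edgeStab v x ≤ T.stab (T.act k (w m))) :
    ∃ f : T.V × T.V → T.V × T.V, (∀ g p, f (T.pact g p) = T.pact g (f p)) ∧
      ∀ p : T.V × T.V, (∃ g : G, T.act g v = p.1) → T.graph.Adj p.1 p.2 →
        (f p).1 = p.1 ∧ f p ∈ T.orbSet v w ∧ (p ∈ T.orbSet v w → f p = p) := by
  have hmain := hlp_equivariant T.pact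
    (fun p q => (∃ g : G, T.act g v = p.1) → T.graph.Adj p.1 p.2 →
        q.1 = p.1 ∧ q ∈ T.orbSet v w ∧ (p ∈ T.orbSet v w → q = p))
  refine Exists.imp (fun f hf => ⟨hf.2, hf.1⟩) (hmain ?_ ?_)
  · rintro g p q hpq ⟨k, hk⟩ hadj
    rw [T.pact_apply] at hk hadj
    obtain ⟨a1, a2, a3⟩ := hpq ⟨g⁻¹ * k, by rw [T.act_mul_apply, hk, T.act_inv_act]⟩
      ((T.adj_act_iff g _ _).1 hadj)
    refine ⟨by rw [T.pact_apply, T.pact_apply, a1], T.orbSet_act v w g q a2, fun hh => ?_⟩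
    rw [a3 ((T.orbSet_act_iff v w g p).1 hh)]
  · intro p
    by_cases hp : p ∈ T.orbSet v w
    · exact ⟨p, fun _ _ => ⟨rfl, hp, fun _ => rfl⟩, fun g hg => hg⟩
    by_cases hD : (∃ g : G, T.act g v = p.1) ∧ T.graph.Adj p.1 p.2
    · obtain ⟨⟨g, hg⟩, hadj⟩ := hD
      have hadj' : T.graph.Adj v (T.act g⁻¹ p.2) := by
        rw [← T.adj_act_iff g, T.act_act_inv, hg]
        exact hadj
      obtain ⟨m, k, hk, hle⟩ := hdom _ hadj'
      refine ⟨(p.1, T.act (g * k) (w m)), fun _ _ => ⟨rfl, ⟨m, g * k, ?_⟩, fun h => (hp h).elim⟩,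
        fun h hh => ?_⟩
      · rw [T.act_mul_apply g k v, hk, hg]
      · rw [T.pact_apply] at hh ⊢
        have e1 : T.act h p.1 = p.1 := congrArg Prod.fst hh
        have e2 : T.act h p.2 = p.2 := congrArg Prod.snd hh
        have hmem : g⁻¹ * h * g ∈ T.edgeStab v (T.act g⁻¹ p.2) := by
          rw [T.mem_edgeStab]
          constructor
          · rw [T.act_mul_apply, T.act_mul_apply, hg, e1, ← hg, T.act_inv_act]
          · rw [T.act_mul_apply, T.act_mul_apply, T.act_act_inv, e2]
        have h3 := hle hmem
        rw [T.mem_stab, T.act_mul_apply, T.act_mul_apply] at h3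
        have h4 := congrArg (T.act g) h3
        rw [T.act_act_inv, ← T.act_mul_apply g k] at h4
        exact Prod.ext e1 h4
    · exact ⟨p, fun a b => (hD ⟨a, b⟩).elim, fun g hg => hg⟩

/-- The expansion data. -/
noncomputable def GTree.expData (T : GTree G) (v : T.V) {M : Type u} (w : M → T.V)
    (hw : ∀ m, T.graph.Adj v (w m))
    (f : T.V × T.V → T.V × T.V) (hf : ∀ g p, f (T.pact g p) = T.pact g (f p))
    (hf2 : ∀ p : T.V × T.V, (∃ g : G, T.act g v = p.1) → T.graph.Adj p.1 p.2 →
        (f p).1 = p.1 ∧ f p ∈ T.orbSet v w ∧ (p ∈ T.orbSet v w → f p = p))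
    (hmv : ∀ m, ∃ g : G, T.act g v = v ∧ T.act g (w m) ≠ w m) : ExpData T where
  N := {p : T.V × T.V // p ∈ T.orbSet v w}
  nact :=
    { toFun := fun g => (T.pact g).subtypeEquiv (fun p => (T.orbSet_act_iff v w g p).symm)
      map_one' := by ext p <;> simp
      map_mul' := fun g h => by ext p <;> simp }
  src := fun n => n.1.1
  src_act := fun g n => rfl
  e := fun a b => if h : f (a, b) ∈ T.orbSet v w ∧ (f (a, b)).1 = a then Sum.inr ⟨f (a, b), h.1⟩
    else Sum.inl a
  e_src := by
    intro a b _
    split_ifs with h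
    · exact h.2
    · rfl
  e_act := by
    intro g a b _
    have e1 : f (T.act g a, T.act g b) = T.pact g (f (a, b)) := hf g (a, b)
    have hiff : (f (T.act g a, T.act g b) ∈ T.orbSet v w ∧
        (f (T.act g a, T.act g b)).1 = T.act g a) ↔
        (f (a, b) ∈ T.orbSet v w ∧ (f (a, b)).1 = a) := by
      rw [e1, T.orbSet_act_iff, T.pact_apply]
      simp
    by_cases h : f (a, b) ∈ T.orbSet v w ∧ (f (a, b)).1 = a
    · rw [dif_pos h, dif_pos (hiff.2 h)]
      simp only [Sum.map_inr]
      congr 1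
      exact Subtype.ext e1
    · rw [dif_neg h, dif_neg (fun h' => h (hiff.1 h'))]
      rfl
  e_inl := by
    rintro a b hab he ⟨p, m, g, rfl⟩ hn
    obtain ⟨h1, h2, -⟩ := hf2 (a, b) ⟨g, hn⟩ hab
    rw [dif_pos ⟨h2, h1⟩] at he
    cases he
  e_surj := by
    rintro ⟨p, hp⟩
    have hadj : T.graph.Adj p.1 p.2 := by
      obtain ⟨m, g, rfl⟩ := hp
      exact T.adj_act g _ _ (hw m)
    have hO : ∃ g : G, T.act g v = p.1 := by
      obtain ⟨m, g, rfl⟩ := hp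
      exact ⟨g, rfl⟩
    obtain ⟨h1, h2, h3⟩ := hf2 p hO hadj
    refine ⟨p.2, hadj, ?_⟩
    rw [dif_pos ⟨h2, h1⟩]
    congr 1
    exact Subtype.ext (h3 hp)
  moved := by
    rintro ⟨p, m, g, rfl⟩
    obtain ⟨k, hk1, hk2⟩ := hmv m
    refine ⟨g * k * g⁻¹, ?_, ?_⟩
    · show T.act (g * k * g⁻¹) (T.act g v) = T.act g v
      rw [T.act_mul_apply, T.act_mul_apply, T.act_inv_act, hk1]
    · intro h
      have h1 : T.pact (g * k * g⁻¹) (T.act g v, T.act g (w m)) = (T.act g v, T.act g (w m)) :=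
        congrArg Subtype.val h
      have h2 : T.act (g * k * g⁻¹) (T.act g (w m)) = T.act g (w m) := congrArg Prod.snd h1
      rw [T.act_mul_apply, T.act_mul_apply, T.act_inv_act] at h2
      exact hk2 ((T.act g).injective h2)

/-- Groups of `𝒜_min` fixing `v` fix an edge at `v`. -/
theorem hlp_amin_edge (T₀ T : GTree G) (hT : SameDef T₀ T) (v : T.V) (H : Subgroup G)
    (hH : H ≤ T.stab v) (hA : Amin T₀ H) : ∃ w, T.graph.Adj v w ∧ H ≤ T.edgeStab v w := by
  obtain ⟨a, b, hab, hle⟩ := hA T hT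
  by_cases hva : v = a
  · subst hva
    exact ⟨b, hab, hle⟩
  · exact T.fix_nbr H v a hva hH (hle.trans inf_le_left)

theorem hlp_part1 [Group.FG G] (T₀ T : GTree G) (hT : SameDef T₀ T)
    (hTr : ∀ u v : T.V, T.graph.Adj u v → Amin T₀ (T.edgeStab u v)) (v : T.V)
    (w : T.V) (hw : T.graph.Adj v w) :
    ∃ w', T.graph.Adj v w' ∧ T.edgeStab v w ≤ T.edgeStab v w' ∧
      PeriphMax T₀ (T.stab v) (T.edgeStab v w') := by
  have := T.finite_nbrOrbits v
  let ES : T.nbrOrbits v → Subgroup G := fun q => T.edgeStab v (Quot.out q).1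
  have hES : ∀ x (hx : T.graph.Adj v x),
      perLe (T.stab v) (T.edgeStab v x) (ES (Quot.mk _ ⟨x, hx⟩)) ∧
      perLe (T.stab v) (ES (Quot.mk _ ⟨x, hx⟩)) (T.edgeStab v x) := by
    intro x hx
    have h1 := hlp_quot_eq (hlp_nbr_equiv T v) (Quot.out_eq (Quot.mk _ ⟨x, hx⟩))
    obtain ⟨g, hg1, hg2⟩ := h1
    obtain ⟨k, hk1, hk2⟩ := (hlp_nbr_equiv T v).symm ⟨g, hg1, hg2⟩
    exact ⟨T.perLe_edge v _ _ k hk1 hk2, T.perLe_edge v _ _ g hg1 hg2⟩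
  let _ : Preorder (T.nbrOrbits v) :=
    { le := fun p q => perLe (T.stab v) (ES p) (ES q)
      le_refl := fun p => perLe_refl _ _
      le_trans := fun p q r h k => perLe_trans h k }
  obtain ⟨m, hm1, hm2⟩ := Finite.exists_le_maximal (p := fun _ : T.nbrOrbits v => True)
    (a := Quot.mk _ ⟨w, hw⟩) trivial
  have hm1' : perLe (T.stab v) (T.edgeStab v w) (ES m) := perLe_trans (hES w hw).1 hm1
  obtain ⟨g, hg, hle⟩ := hm1'
  have hgi : T.act g⁻¹ v = v := (T.stab v).inv_mem hg
  have hadj : T.graph.Adj v (T.act g⁻¹ (Quot.out m).1) := by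
    have := T.adj_act g⁻¹ _ _ (Quot.out m).2
    rwa [hgi] at this
  have p1 : perLe (T.stab v) (T.edgeStab v (T.act g⁻¹ (Quot.out m).1)) (ES m) :=
    T.perLe_edge v _ _ g hg (T.act_act_inv _ _)
  have p2 : perLe (T.stab v) (ES m) (T.edgeStab v (T.act g⁻¹ (Quot.out m).1)) :=
    T.perLe_edge v _ _ g⁻¹ hgi rfl
  refine ⟨T.act g⁻¹ (Quot.out m).1, hadj, ?_, inf_le_left, hTr _ _ hadj, ?_⟩
  · intro h hh
    refine ⟨hh.1, ?_⟩
    have h1 : g * h * g⁻¹ ∈ T.stab (Quot.out m).1 := (hle h hh).2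
    rw [T.mem_stab, T.act_mul_apply, T.act_mul_apply] at h1
    have h2 := congrArg (T.act g⁻¹) h1
    rw [T.act_inv_act] at h2
    exact h2
  · intro K hK hKA hperK
    obtain ⟨x, hx, hKx⟩ := hlp_amin_edge T₀ T hT v K hK hKA
    have q1 : perLe (T.stab v) K (ES (Quot.mk _ ⟨x, hx⟩)) :=
      perLe_trans (perLe_of_le _ hKx) (hES x hx).1
    have q2 : perLe (T.stab v) (ES (Quot.mk _ ⟨x, hx⟩)) (ES m) :=
      hm2.2 trivial (perLe_trans p2 (perLe_trans hperK q1))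
    exact perLe_trans q1 (perLe_trans q2 p2)

theorem hlp_part2 (T₀ T : GTree G) (hT : SameDef T₀ T)
    (hTr : ∀ u v : T.V, T.graph.Adj u v → Amin T₀ (T.edgeStab u v)) (v : T.V)
    (H : Subgroup G) (hH : PeriphMax T₀ (T.stab v) H) :
    ∃ w : T.V, T.graph.Adj v w ∧
      perLe (T.stab v) (T.edgeStab v w) H ∧ perLe (T.stab v) H (T.edgeStab v w) := by
  obtain ⟨w, hw, hle⟩ := hlp_amin_edge T₀ T hT v H hH.1 hH.2.1
  exact ⟨w, hw, hH.2.2 _ inf_le_left (hTr _ _ hw) (perLe_of_le _ hle), perLe_of_le _ hle⟩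

/-- Choice of an edge at `v` for each element of the peripheral structure. -/
theorem hlp_choice [Group.FG G] (T₀ T : GTree G) (hT : SameDef T₀ T)
    (hTr : ∀ u v : T.V, T.graph.Adj u v → Amin T₀ (T.edgeStab u v)) (v : T.V) :
    ∃ w : periphSet T₀ (T.stab v) → T.V, (∀ m, T.graph.Adj v (w m)) ∧
      (∀ m m' (g : G), T.act g v = v → T.act g (w m) = w m' → m = m') ∧
      (∀ x, T.graph.Adj v x → ∃ m, ∃ k : G, T.act k v = v ∧
        T.edgeStab v x ≤ T.stab (T.act k (w m))) := by
  have hch : ∀ m : periphSet T₀ (T.stab v), ∃ w, T.graph.Adj v w ∧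
      perLe (T.stab v) (T.edgeStab v w) (Quot.out m).1 ∧
      perLe (T.stab v) (Quot.out m).1 (T.edgeStab v w) := fun m =>
    hlp_part2 T₀ T hT hTr v _ (Quot.out m).2
  choose w hw1 hw2 hw3 using hch
  refine ⟨w, hw1, ?_, ?_⟩
  · intro m m' g hg hgm
    have hgi : T.act g⁻¹ v = v := (T.stab v).inv_mem hg
    have h1 := T.perLe_edge v _ _ g hg hgm
    have h2 := T.perLe_edge v (w m') (w m) g⁻¹ hgi (by rw [← hgm, T.act_inv_act])
    rw [← Quot.out_eq m, ← Quot.out_eq m']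
    exact Quot.sound ⟨perLe_trans (hw3 m) (perLe_trans h1 (hw2 m')),
      perLe_trans (hw3 m') (perLe_trans h2 (hw2 m))⟩
  · intro x hx
    obtain ⟨w', _, hle, hmax⟩ := hlp_part1 T₀ T hT hTr v x hx
    let m : periphSet T₀ (T.stab v) := Quot.mk _ ⟨T.edgeStab v w', hmax⟩
    have hm := hlp_quot_eq (hlp_periph_equiv T₀ (T.stab v)) (Quot.out_eq m)
    obtain ⟨k, hk, hkle⟩ := perLe_trans hm.2 (hw3 m)
    refine ⟨m, k⁻¹, (T.stab v).inv_mem hk, fun h hh => ?_⟩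
    have h1 : k * h * k⁻¹ ∈ T.stab (w m) := (hkle h (hle hh)).2
    rw [T.mem_stab, T.act_mul_apply, T.act_mul_apply] at h1
    have h2 := congrArg (T.act k⁻¹) h1
    rw [T.act_inv_act] at h2
    exact h2

theorem hlp_part4 [Group.FG G] (T₀ T : GTree G) (hT : SameDef T₀ T)
    (hTr : ∀ u v : T.V, T.graph.Adj u v → Amin T₀ (T.edgeStab u v)) (v : T.V)
    (hnot : ¬ Amin T₀ (T.stab v)) :
    ∃ (T' : GTree G) (v' : T'.V), SameDef T₀ T' ∧
      (∀ u w : T'.V, T'.graph.Adj u w → Amin T₀ (T'.edgeStab u w)) ∧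
      T'.stab v' = T.stab v ∧
      Cardinal.mk (periphSet T₀ (T.stab v)) = Cardinal.mk (T'.nbrOrbits v') := by
  obtain ⟨w, hw, hinj, hdom⟩ := hlp_choice T₀ T hT hTr v
  obtain ⟨f, hf, hf2⟩ := T.exists_retraction v w hdom
  have hmv : ∀ m, ∃ g : G, T.act g v = v ∧ T.act g (w m) ≠ w m := by
    intro m
    by_contra hcon
    push Not at hcon
    have hle : T.stab v ≤ T.edgeStab v (w m) := fun g hg => ⟨hg, hcon g hg⟩
    exact hnot (Amin_mono T₀ hle (hTr _ _ (hw m)))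
  let E := T.expData v w hw f hf hf2 hmv
  have hsrc : ∀ n : E.N, E.src n = n.1.1 := fun n => rfl
  have hnact : ∀ (g : G) (n : E.N), (E.nact g n).1 = T.pact g n.1 := fun g n => rfl
  have hadjN : ∀ n : E.N, T.graph.Adj n.1.1 n.1.2 := by
    rintro ⟨p, m, g, rfl⟩
    exact T.adj_act g _ _ (hw m)
  have hstabN : ∀ (n : E.N) (g : G), E.nact g n = n → g ∈ T.edgeStab n.1.1 n.1.2 := by
    intro n g h
    have h1 : T.pact g n.1 = n.1 := congrArg Subtype.val h
    exact ⟨congrArg Prod.fst h1, congrArg Prod.snd h1⟩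
  let nn : periphSet T₀ (T.stab v) → E.N := fun m =>
    ⟨(v, w m), m, 1, by rw [T.act_one_apply, T.act_one_apply]⟩
  have hnn : ∀ m, E.graph.Adj (Sum.inl v) (Sum.inr (nn m)) := fun m => ExpData.NAdj.up (nn m)
  refine ⟨E.tree, (Sum.inl v : T.V ⊕ E.N), fun H => (hT H).trans (E.sameDef H), ?_, ?_, ?_⟩
  · rintro _ _ (n | n | ⟨a, b, hab⟩)
    · refine Amin_mono T₀ (fun g hg => ?_) (hTr _ _ (hadjN n))
      exact hstabN n g (Sum.inr.inj hg.2)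
    · refine Amin_mono T₀ (fun g hg => ?_) (hTr _ _ (hadjN n))
      exact hstabN n g (Sum.inr.inj hg.1)
    · refine Amin_mono T₀ (fun g hg => ?_) (hTr _ _ hab)
      have h1 := congrArg E.c (show E.act g (E.e a b) = E.e a b from hg.1)
      have h2 := congrArg E.c (show E.act g (E.e b a) = E.e b a from hg.2)
      rw [E.c_act, E.c_e a b hab] at h1
      rw [E.c_act, E.c_e b a hab.symm] at h2
      exact ⟨h1, h2⟩
  · ext g
    exact ⟨fun h => Sum.inl.inj h, fun h => congrArg Sum.inl h⟩
  · let F : periphSet T₀ (T.stab v) → E.tree.nbrOrbits (Sum.inl v : T.V ⊕ E.N) := fun m =>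
      Quot.mk _ ⟨(Sum.inr (nn m) : T.V ⊕ E.N), hnn m⟩
    refine Cardinal.mk_congr (Equiv.ofBijective F ⟨?_, ?_⟩)
    · intro m m' h
      obtain ⟨g, h1, h2⟩ := hlp_quot_eq (hlp_nbr_equiv E.tree _) h
      have h1' : T.act g v = v := Sum.inl.inj h1
      have h2' : E.nact g (nn m) = nn m' := Sum.inr.inj h2
      have h3 : T.pact g (v, w m) = (v, w m') := congrArg Subtype.val h2'
      exact hinj m m' g h1' (congrArg Prod.snd h3)
    · intro q
      induction q using Quot.ind with
      | mk x =>
        obtain ⟨x, hx⟩ := x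
        have key : ∀ y x : T.V ⊕ E.N, E.NAdj y x → y = Sum.inl v →
            ∃ n : E.N, x = Sum.inr n ∧ E.src n = v := by
          rintro _ _ (n | n | ⟨a, b, hab⟩) hy
          · exact ⟨n, rfl, Sum.inl.inj hy⟩
          · cases hy
          · exfalso
            have h1 := congrArg E.c hy
            rw [E.c_e a b hab, E.c_inl] at h1
            subst h1
            obtain ⟨m, -⟩ := hdom b hab
            exact E.e_inl a b hab hy (nn m) rfl
        obtain ⟨n, rfl, hn⟩ := key _ _ hx rfl
        obtain ⟨p, m, g, rfl⟩ := n
        refine ⟨m, Quot.sound ⟨g, ?_, ?_⟩⟩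
        · exact congrArg Sum.inl hn
        · show E.act g (Sum.inr (nn m)) = _
          rw [E.act_inr]
          exact congrArg Sum.inr (Subtype.ext rfl)

end HelperMain

/-- **Proposition (Guirardel–Levitt, Proposition 4.11).** Let `G₀ ∉ 𝒜_min` be a maximal
elliptic subgroup, with peripheral structure `ℳ₀`, of the deformation space `D` of `T₀`,
let `T` be a tree in the reduced deformation space `D_r` (edge stabilizers in `𝒜_min`),
and let `v` be the vertex with stabilizer `G₀`.  Then: (1) the stabilizer of any edge
adjacent to `v` is contained in a group belonging to some `m ∈ ℳ₀`; (2) every `m ∈ ℳ₀`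
contains the stabilizer of some edge adjacent to `v`; (3) the image of `v` in the
quotient graph has valence at least `|ℳ₀|`, and `ℳ₀` is finite; (4) some `T' ∈ D_r`
realizes the equality in (3). -/
theorem statement_6 {G : Type u} [Group G] [Group.FG G] (T₀ : GTree G)
    (G₀ : Subgroup G) (hmax : MaxElliptic T₀ G₀) (hnot : ¬Amin T₀ G₀)
    (T : GTree G) (hT : SameDef T₀ T)
    (hTr : ∀ u v : T.V, T.graph.Adj u v → Amin T₀ (T.edgeStab u v))
    (v : T.V) (hv : T.stab v = G₀) :
    (∀ w : T.V, T.graph.Adj v w →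
      ∃ H : Subgroup G, PeriphMax T₀ G₀ H ∧ T.edgeStab v w ≤ H) ∧
    (∀ H : Subgroup G, PeriphMax T₀ G₀ H → ∃ w : T.V, T.graph.Adj v w ∧
      perLe G₀ (T.edgeStab v w) H ∧ perLe G₀ H (T.edgeStab v w)) ∧
    (Finite (periphSet T₀ G₀) ∧
      Cardinal.mk (periphSet T₀ G₀) ≤ Cardinal.mk (T.nbrOrbits v)) ∧
    (∃ (T' : GTree G) (v' : T'.V), SameDef T₀ T' ∧
      (∀ u w : T'.V, T'.graph.Adj u w → Amin T₀ (T'.edgeStab u w)) ∧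
      T'.stab v' = G₀ ∧
      Cardinal.mk (periphSet T₀ G₀) = Cardinal.mk (T'.nbrOrbits v')) := by
  subst hv
  obtain ⟨w, hw, hinj, hdom⟩ := hlp_choice T₀ T hT hTr v
  have hI : Function.Injective (fun m : periphSet T₀ (T.stab v) =>
      (Quot.mk _ ⟨w m, hw m⟩ : T.nbrOrbits v)) := by
    intro m m' h
    obtain ⟨g, h1, h2⟩ := hlp_quot_eq (hlp_nbr_equiv T v) h
    exact hinj m m' g h1 h2
  have hfin : Finite (T.nbrOrbits v) := T.finite_nbrOrbits v
  refine ⟨?_, hlp_part2 T₀ T hT hTr v, ⟨@Finite.of_injective _ _ hfin _ hI, Cardinal.mk_le_of_injective hI⟩,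
    hlp_part4 T₀ T hT hTr v hnot⟩
  intro x hx
  obtain ⟨w', _, hle, hmax'⟩ := hlp_part1 T₀ T hT hTr v x hx
  exact ⟨_, hmax', hle⟩
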